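/- arXiv:1905.09750 — 7 statements merged into one kernel-verified Lean document; each statement's English description precedes it below -/
import Mathlib

section
/- Consider a GEBP instance with f_i = c_i·σ_i and σ_i ≥ 1 for all machines i, and let h be a machine with σ_h = 1. Let S be a set of machines with h ∉ S, let A be an assignment, and let A' be the assignment obtained from A by reassigning every job that A assigns to a machine in S to machine h (all other jobs unchanged). Then cost(A') ≤ cost(A) + Σ_{i∈S} f_i. -/
/-- The machine cost function: `cost(L) = f` if `L ≤ c`, and `f + σ·(L - c)` otherwise. -/
noncomputable def mcost (f c σ L : ℝ) : ℝ := if L ≤ c then f else f + σ * (L - c)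

/-- The load of machine `i` under assignment `A` with job sizes `p`. -/
noncomputable def mload {m n : ℕ} (p : Fin n → ℝ) (A : Fin n → Fin m) (i : Fin m) : ℝ :=
  ∑ j ∈ Finset.univ.filter (fun j => A j = i), p j

/-- The total cost of assignment `A` in the GEBP instance `(f, c, σ, p)`. -/
noncomputable def gcost {m n : ℕ} (f c σ : Fin m → ℝ) (p : Fin n → ℝ)
    (A : Fin n → Fin m) : ℝ :=
  ∑ i, mcost (f i) (c i) (σ i) (mload p A i)

theorem le_mcost {f c σ L : ℝ} (hσ : 1 ≤ σ) (hfcσ : f = c * σ) (hc : 0 < c) (hL : 0 ≤ L) :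
    L ≤ mcost f c σ L := by
  unfold mcost
  split_ifs <;> nlinarith

theorem mcost_add_le_of_slope_one {f c L x : ℝ} (hx : 0 ≤ x) :
    mcost f c 1 (L + x) ≤ mcost f c 1 L + x := by
  unfold mcost
  split_ifs <;> linarith

theorem mload_nonneg {m n : ℕ} {p : Fin n → ℝ} (hp : ∀ j, 0 ≤ p j) (A : Fin n → Fin m)
    (i : Fin m) : 0 ≤ mload p A i :=
  Finset.sum_nonneg fun j _ => hp j

theorem sum_mload {m n : ℕ} (p : Fin n → ℝ) (A : Fin n → Fin m) (S : Finset (Fin m)) :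
    ∑ i ∈ S, mload p A i = ∑ j, if A j ∈ S then p j else 0 := by
  simp only [mload, Finset.sum_filter]
  rw [Finset.sum_comm]
  simp

section Reassign

variable {m n : ℕ} (p : Fin n → ℝ) (A : Fin n → Fin m) {S : Finset (Fin m)} {h : Fin m}

theorem mload_reassign_of_mem (hhS : h ∉ S) {i : Fin m} (hi : i ∈ S) :
    mload p (fun j => if A j ∈ S then h else A j) i = 0 := by
  refine Finset.sum_eq_zero fun j hj => ?_
  simp only [Finset.mem_filter, Finset.mem_univ, true_and] at hj
  split_ifs at hj <;> simp_all

theorem mload_reassign_of_notMem {i : Fin m} (hi : i ∉ S) (hih : i ≠ h) :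
    mload p (fun j => if A j ∈ S then h else A j) i = mload p A i := by
  unfold mload
  congr 1
  ext j
  simp only [Finset.mem_filter, Finset.mem_univ, true_and]
  split_ifs <;> grind

theorem mload_reassign_target (hhS : h ∉ S) :
    mload p (fun j => if A j ∈ S then h else A j) h =
      mload p A h + ∑ i ∈ S, mload p A i := by
  rw [sum_mload]
  simp only [mload, Finset.sum_filter]
  rw [← Finset.sum_add_distrib]
  refine Finset.sum_congr rfl fun j _ => ?_
  split_ifs <;> grind

end Reassign

theorem stmt5 (m n : ℕ) (f c σ : Fin m → ℝ) (p : Fin n → ℝ)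
    (hf : ∀ i, 0 < f i) (hc : ∀ i, 0 < c i) (hσ : ∀ i, 1 ≤ σ i)
    (hfcσ : ∀ i, f i = c i * σ i) (hp : ∀ j, 0 ≤ p j)
    (h : Fin m) (hσh : σ h = 1) (S : Finset (Fin m)) (hhS : h ∉ S)
    (A : Fin n → Fin m) :
    gcost f c σ p (fun j => if A j ∈ S then h else A j) ≤
      gcost f c σ p A + ∑ i ∈ S, f i := by
  have key : ∀ i, mcost (f i) (c i) (σ i) (mload p (fun j => if A j ∈ S then h else A j) i) ≤
      mcost (f i) (c i) (σ i) (mload p A i) + (if i ∈ S then f i - mload p A i else 0) +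
        (if i = h then ∑ k ∈ S, mload p A k else 0) := by
    intro i
    by_cases hi : i ∈ S
    · have hih : i ≠ h := fun e => hhS (e ▸ hi)
      have hle := le_mcost (hσ i) (hfcσ i) (hc i) (mload_nonneg hp A i)
      have h0 : mcost (f i) (c i) (σ i) 0 = f i := if_pos (hc i).le
      rw [mload_reassign_of_mem p A hhS hi, h0, if_pos hi, if_neg hih]
      linarith
    · by_cases hih : i = h
      · subst hih
        rw [mload_reassign_target p A hhS, if_neg hi, if_pos rfl, hσh, add_zero]
        exact mcost_add_le_of_slope_one (Finset.sum_nonneg fun k _ => mload_nonneg hp A k)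
      · rw [mload_reassign_of_notMem p A hi hih, if_neg hi, if_neg hih, add_zero, add_zero]
  refine (Finset.sum_le_sum fun i _ => key i).trans_eq ?_
  simp only [gcost, Finset.sum_add_distrib, Finset.sum_ite_mem, Finset.univ_inter,
    Finset.sum_ite_eq', Finset.mem_univ, if_true, Finset.sum_sub_distrib]
  ring
end

section
/- Consider a GEBP instance with f_i = c_i·σ_i and σ_i ≥ 1 for all machines i, let h be a machine with σ_h = 1, and let ε > 0. Then for every assignment A there exists a nice assignment A' (i.e., for every machine i ≠ h the load of i under A' is at most c_i/ε) with cost(A') ≤ (1+ε)·cost(A). -/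
theorem mcost_eq_mul_max {f c σ : ℝ} (hf : f = c * σ) (L : ℝ) :
    mcost f c σ L = σ * max c L := by
  unfold mcost
  split_ifs with hL
  · rw [max_eq_left hL, hf, mul_comm]
  · rw [max_eq_right (not_le.mp hL).le, hf]
    ring

/-- Redirecting whole machines along `r` adds up the loads of the machines sent to `i`. -/
theorem mload_comp {m n : ℕ} (p : Fin n → ℝ) (A : Fin n → Fin m) (r : Fin m → Fin m)
    (i : Fin m) : mload p (fun j => r (A j)) i = ∑ k, if r k = i then mload p A k else 0 := by
  simp only [mload, Finset.sum_filter]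
  have key : ∀ k, (if r k = i then ∑ j, (if A j = k then p j else 0) else 0) =
      ∑ j, if A j = k then (if r k = i then p j else 0) else 0 := by
    intro k
    split_ifs <;> simp
  rw [Finset.sum_congr rfl fun k _ => key k, Finset.sum_comm]
  simp

theorem stmt6 (m n : ℕ) (f c σ : Fin m → ℝ) (p : Fin n → ℝ)
    (hf : ∀ i, 0 < f i) (hc : ∀ i, 0 < c i) (hσ : ∀ i, 1 ≤ σ i)
    (hfcσ : ∀ i, f i = c i * σ i) (hp : ∀ j, 0 ≤ p j)
    (h : Fin m) (hσh : σ h = 1) (ε : ℝ) (hε : 0 < ε)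
    (A : Fin n → Fin m) :
    ∃ A' : Fin n → Fin m,
      (∀ i, i ≠ h → mload p A' i ≤ c i / ε) ∧
      gcost f c σ p A' ≤ (1 + ε) * gcost f c σ p A := by
  classical
  let bad : Fin m → Prop := fun i => i ≠ h ∧ c i / ε < mload p A i
  let r : Fin m → Fin m := fun i => if bad i then h else i
  let b : Fin m → ℝ := fun i => if bad i then mload p A i else 0
  have hL := mload_nonneg hp A
  have load_ne : ∀ i, i ≠ h →
      mload p (fun j => r (A j)) i = if bad i then 0 else mload p A i := by
    intro i hi
    rw [mload_comp, Finset.sum_eq_single i]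
    · by_cases hb : bad i
      · simp [r, hb, hi.symm]
      · simp [r, hb]
    · intro k _ hk
      by_cases hb : bad k
      · simp [r, hb, hi.symm]
      · simp [r, hb, hk]
    · simp
  have load_h : mload p (fun j => r (A j)) h = mload p A h + ∑ i, b i := by
    have split : ∀ k, (if r k = h then mload p A k else 0) =
        (if k = h then mload p A k else 0) + b k := by
      intro k
      by_cases hk : k = h
      · subst hk
        simp [r, b, bad]
      · by_cases hb : bad k
        · simp [r, b, hb, hk]
        · simp [r, b, hb, hk]
    rw [mload_comp, Finset.sum_congr rfl fun k _ => split k, Finset.sum_add_distrib]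
    simp
  have b_nonneg : 0 ≤ ∑ i, b i := by
    refine Finset.sum_nonneg fun i _ => ?_
    simp only [b]
    split_ifs
    exacts [hL i, le_rfl]
  refine ⟨fun j => r (A j), fun i hi => ?_, ?_⟩
  · rw [load_ne i hi]
    split_ifs with hb
    · exact (div_pos (hc i) hε).le
    · exact not_lt.mp fun hlt => hb ⟨hi, hlt⟩
  · have bound : ∀ i, mcost (f i) (c i) (σ i) (mload p (fun j => r (A j)) i) ≤
        (1 + ε) * mcost (f i) (c i) (σ i) (mload p A i) - b i +
          if i = h then ∑ k, b k else 0 := by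
      intro i
      have hσ0 : 0 ≤ σ i := zero_le_one.trans (hσ i)
      rw [mcost_eq_mul_max (hfcσ i), mcost_eq_mul_max (hfcσ i)]
      have hmax : 0 ≤ max (c i) (mload p A i) := (hc i).le.trans (le_max_left _ _)
      have hcost : 0 ≤ ε * (σ i * max (c i) (mload p A i)) := by positivity
      by_cases hi : i = h
      · subst hi
        have hb : b i = 0 := by simp [b, bad]
        rw [load_h, hσh, hb, if_pos rfl]
        rw [hσh] at hcost
        have : max (c i) (mload p A i + ∑ k, b k) ≤ max (c i) (mload p A i) + ∑ k, b k :=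
          max_le ((le_max_left _ _).trans (le_add_of_nonneg_right b_nonneg))
            (by gcongr; exact le_max_right _ _)
        linarith
      · rw [load_ne i hi, if_neg hi]
        by_cases hb : bad i
        · have hbi : b i = mload p A i := if_pos hb
          rw [if_pos hb, hbi, max_eq_left (hc i).le]
          have hlt : c i ≤ ε * mload p A i := by
            have := (div_lt_iff₀ hε).mp hb.2
            linarith
          have h1 : σ i * c i ≤ ε * (σ i * max (c i) (mload p A i)) :=
            calc σ i * c i ≤ σ i * (ε * max (c i) (mload p A i)) := by
                  gcongr
                  exact hlt.trans (by gcongr; exact le_max_right _ _)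
              _ = _ := by ring
          have h2 : mload p A i ≤ σ i * max (c i) (mload p A i) :=
            (le_max_right _ _).trans (le_mul_of_one_le_left hmax (hσ i))
          linarith
        · have hbi : b i = 0 := if_neg hb
          rw [if_neg hb, hbi]
          linarith
    unfold gcost
    refine (Finset.sum_le_sum fun i _ => bound i).trans (le_of_eq ?_)
    rw [Finset.sum_add_distrib, Finset.sum_sub_distrib, Finset.mul_sum]
    simp
end

section
/- Let ε ∈ (0,1) be such that 1/ε is an integer, let t be an integer, and let c_1 ≥ c_2 ≥ ⋯ ≥ c_k > 0 be reals such that c_j / c_{j+1} < (1/ε)² for every j ∈ {1,…,k−1}, and such that at most one index j ∈ {1,…,k} satisfies ⌈log_{1/ε²} c_j⌉ ≡ t (mod 1/ε). Then c_1 / c_k ≤ (1/ε)^{4/ε}. -/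
/-- Discrete intermediate value theorem: an integer sequence that decreases by at most one at each
step takes every value between its first and last terms. -/
theorem exists_eq_of_le_add_one (m : ℕ → ℤ) (v : ℤ) (h0 : v ≤ m 0) (n : ℕ)
    (hstep : ∀ j, j < n → m j ≤ m (j + 1) + 1) (hn : m n ≤ v) : ∃ j ≤ n, m j = v := by
  induction n with
  | zero => exact ⟨0, le_rfl, le_antisymm hn h0⟩
  | succ n ih =>
    by_cases h : m n ≤ v
    · obtain ⟨j, hj, hjv⟩ := ih (fun j hj => hstep j (by omega)) h
      exact ⟨j, by omega, hjv⟩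
    · have := hstep n (by omega)
      exact ⟨n + 1, le_rfl, by omega⟩

theorem stmt9 (ε : ℝ) (hε0 : 0 < ε) (hε1 : ε < 1)
    (N : ℕ) (hN : (N : ℝ) = 1/ε)
    (k : ℕ) (hk : 0 < k) (c : ℕ → ℝ) (t : ℤ)
    (hcpos : ∀ j, j < k → 0 < c j)
    (hsorted : ∀ j, j + 1 < k → c (j + 1) ≤ c j)
    (hratio : ∀ j, j + 1 < k → c j / c (j + 1) < (1/ε)^2)
    (huniq : ∀ j1 j2, j1 < k → j2 < k →
      ⌈Real.logb ((1/ε)^2) (c j1)⌉ % (N : ℤ) = t % (N : ℤ) →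
      ⌈Real.logb ((1/ε)^2) (c j2)⌉ % (N : ℤ) = t % (N : ℤ) → j1 = j2) :
    c 0 / c (k - 1) ≤ (1/ε) ^ ((4:ℝ)/ε) := by
  have hN1 : (1 : ℝ) < 1 / ε := by rw [lt_div_iff₀ hε0]; linarith
  have hNpos : (0 : ℤ) < N := by
    have : (0 : ℝ) < N := by rw [hN]; linarith
    exact_mod_cast this
  have hb : (1 : ℝ) < (1 / ε) ^ 2 := one_lt_pow₀ hN1 two_ne_zero
  set b : ℝ := (1 / ε) ^ 2 with hbdef
  have hlast : k - 1 < k := by omega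
  set m : ℕ → ℤ := fun j => ⌈Real.logb b (c j)⌉ with hm
  have hstep : ∀ j, j < k - 1 → m j ≤ m (j + 1) + 1 := by
    intro j hj
    have hj0 := hcpos j (by omega)
    have hj1 := hcpos (j + 1) (by omega)
    have hlog : Real.logb b (c j / c (j + 1)) < 1 := by
      rw [Real.logb_lt_iff_lt_rpow hb (div_pos hj0 hj1), Real.rpow_one]
      exact hratio j (by omega)
    rw [Real.logb_div hj0.ne' hj1.ne'] at hlog
    have hceil := Int.le_ceil (Real.logb b (c (j + 1)))
    simp only [hm]
    rw [Int.ceil_le]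
    push_cast
    linarith
  have hgap : m 0 < m (k - 1) + 2 * N - 1 := by
    by_contra! hge
    set r : ℤ := (t - m (k - 1)) % N with hr
    have hr0 : 0 ≤ r := Int.emod_nonneg _ hNpos.ne'
    have hrN : r < N := Int.emod_lt_of_pos _ hNpos
    have hmod : (m (k - 1) + r) % (N : ℤ) = t % (N : ℤ) := by
      rw [hr, Int.add_emod, Int.emod_emod, ← Int.add_emod]
      congr 1
      ring
    obtain ⟨i, hi, hiv⟩ :=
      exists_eq_of_le_add_one m (m (k - 1) + r) (by omega) (k - 1) hstep (by omega)
    obtain ⟨j, hj, hjv⟩ :=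
      exists_eq_of_le_add_one m (m (k - 1) + r + N) (by omega) (k - 1) hstep (by omega)
    have hij : i = j := by
      refine huniq i j (by omega) (by omega) ?_ ?_
      · change m i % (N : ℤ) = _
        rw [hiv, hmod]
      · change m j % (N : ℤ) = _
        rw [hjv, Int.add_emod_right, hmod]
    rw [hij] at hiv
    omega
  have hc0 := hcpos 0 hk
  have hcl := hcpos (k - 1) hlast
  have hgap' : (m 0 : ℝ) < m (k - 1) + 2 * N - 1 := by exact_mod_cast hgap
  have hfirst : Real.logb b (c 0) ≤ m 0 := Int.le_ceil _
  have hend : (m (k - 1) : ℝ) < Real.logb b (c (k - 1)) + 1 := Int.ceil_lt_add_one _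
  have hpow : (1 / ε) ^ ((4 : ℝ) / ε) = b ^ (2 * (N : ℝ)) := by
    rw [hbdef, ← Real.rpow_natCast, ← Real.rpow_mul (by positivity), hN]
    congr 1
    push_cast
    ring
  rw [hpow, ← Real.logb_le_iff_le_rpow hb (div_pos hc0 hcl), Real.logb_div hc0.ne' hcl.ne']
  linarith
end

section
/- Let ε ∈ (0, 1/2] be such that 1/ε is an integer, and let c_ℓ ≥ c_r > 0 satisfy c_ℓ / c_r ≤ (1/ε)^{4/ε}. Then the set { round(p) : ε·c_r ≤ p ≤ c_ℓ/ε } has fewer than 7/ε⁴ elements. -/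
/-- `tau ε p` is the unique integer `τ` with `(1/ε)^τ ≤ p < (1/ε)^(τ+1)` (for `0 < ε < 1`, `p > 0`). -/
noncomputable def tau (ε p : ℝ) : ℤ := ⌊Real.logb (1/ε) p⌋

/-- The rounded size `round(p) = ⌈p / (1/ε)^(τ(p)-1)⌉ · (1/ε)^(τ(p)-1)`. -/
noncomputable def rnd (ε p : ℝ) : ℝ :=
  (⌈p / (1/ε) ^ (tau ε p - 1)⌉ : ℝ) * (1/ε) ^ (tau ε p - 1)

/-- The rounded size of `p` is `k * b ^ (τ(p) - 1)` with `1 ≤ k ≤ b ^ 2`, where `b = 1/ε = N`. -/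
theorem ceil_div_zpow_tau_mem_Icc {ε p : ℝ} {N : ℕ} (hN : (N : ℝ) = 1 / ε) (hN2 : 2 ≤ N)
    (hp : 0 < p) : ⌈p / (1 / ε) ^ (tau ε p - 1)⌉ ∈ Finset.Icc (1 : ℤ) ((N : ℤ) ^ 2) := by
  have hb : (1 : ℝ) < N := by exact_mod_cast hN2
  have hb0 : (0 : ℝ) < N := by linarith
  rw [← hN, Finset.mem_Icc]
  constructor
  · exact Int.one_le_ceil_iff.mpr (by positivity)
  · have hlt : p < (N : ℝ) ^ (tau ε p + 1) := by
      have h := Int.lt_floor_add_one (Real.logb (N : ℝ) p)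
      rw [Real.logb_lt_iff_lt_rpow hb hp] at h
      rw [tau, ← hN, ← Real.rpow_intCast]
      exact_mod_cast h
    rw [Int.ceil_le, div_le_iff₀ (by positivity)]
    push_cast
    have he : (N : ℝ) ^ 2 * (N : ℝ) ^ (tau ε p - 1) = (N : ℝ) ^ (tau ε p + 1) := by
      rw [← zpow_natCast, ← zpow_add₀ hb0.ne']
      congr 1
      push_cast
      ring
    rw [he]
    exact hlt.le

/-- The exponents `τ(p)` of sizes `p ∈ [ε * cr, cl / ε]` lie in a window of `4 * N + 3` integers. -/
theorem tau_mem_Icc {ε p cl cr : ℝ} {N : ℕ} (hN : (N : ℝ) = 1 / ε) (hN2 : 2 ≤ N)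
    (hcr : 0 < cr) (hratio : cl / cr ≤ (1 / ε) ^ ((4 : ℝ) / ε))
    (h1 : ε * cr ≤ p) (h2 : p ≤ cl / ε) :
    tau ε p ∈ Finset.Icc (tau ε cr - 1) (tau ε cr + (4 * N + 1)) := by
  have hb : (1 : ℝ) < N := by exact_mod_cast hN2
  have hb0 : (0 : ℝ) < N := by linarith
  have hε : ε = (N : ℝ)⁻¹ := by rw [hN, one_div, inv_inv]
  have hlow : cr / N ≤ p := by
    rw [hε] at h1
    rwa [div_eq_inv_mul]
  have hp : 0 < p := lt_of_lt_of_le (by positivity) hlow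
  have hexp : (4 : ℝ) / ε = 4 * N := by rw [hε, div_inv_eq_mul]
  rw [hexp, ← hN, div_le_iff₀ hcr] at hratio
  have hup : p ≤ (N : ℝ) ^ (4 * (N : ℝ)) * cr * N := by
    rw [hε, div_inv_eq_mul] at h2
    exact h2.trans (by gcongr)
  have hlog_low := Real.logb_le_logb_of_le hb (by positivity) hlow
  have hlog_up := Real.logb_le_logb_of_le hb hp hup
  rw [Real.logb_div hcr.ne' hb0.ne', Real.logb_self_eq_one hb] at hlog_low
  rw [Real.logb_mul (by positivity) hb0.ne', Real.logb_mul (by positivity) hcr.ne',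
    Real.logb_rpow hb0 hb.ne', Real.logb_self_eq_one hb] at hlog_up
  have hfl := Int.floor_le (Real.logb (N : ℝ) cr)
  have hfu := Int.lt_floor_add_one (Real.logb (N : ℝ) cr)
  rw [Finset.mem_Icc, tau, tau, ← hN]
  constructor
  · rw [Int.le_floor]
    push_cast
    linarith
  · rw [← Int.lt_add_one_iff, Int.floor_lt]
    push_cast
    linarith

theorem stmt11 (ε : ℝ) (hε0 : 0 < ε) (hε1 : ε ≤ 1/2)
    (N : ℕ) (hN : (N : ℝ) = 1/ε)
    (cl cr : ℝ) (hcr : 0 < cr) (hlr : cr ≤ cl)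
    (hratio : cl / cr ≤ (1/ε) ^ ((4:ℝ)/ε)) :
    {x : ℝ | ∃ p : ℝ, ε * cr ≤ p ∧ p ≤ cl / ε ∧ rnd ε p = x}.Finite ∧
    {x : ℝ | ∃ p : ℝ, ε * cr ≤ p ∧ p ≤ cl / ε ∧ rnd ε p = x}.ncard < 7 * N ^ 4 := by
  have hN2 : 2 ≤ N := by
    have h : (2 : ℝ) ≤ N := by
      rw [hN, le_div_iff₀ hε0]
      linarith
    exact_mod_cast h
  set S : Set ℝ := {x : ℝ | ∃ p : ℝ, ε * cr ≤ p ∧ p ≤ cl / ε ∧ rnd ε p = x}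
  let T : Finset ℝ := (Finset.Icc (tau ε cr - 1) (tau ε cr + (4 * N + 1)) ×ˢ
    Finset.Icc (1 : ℤ) ((N : ℤ) ^ 2)).image fun q => (q.2 : ℝ) * (1 / ε) ^ (q.1 - 1)
  have hsub : S ⊆ T := by
    rintro x ⟨p, h1, h2, rfl⟩
    have hp : 0 < p := lt_of_lt_of_le (by positivity) h1
    exact Finset.mem_coe.mpr (Finset.mem_image.mpr
      ⟨(tau ε p, ⌈p / (1 / ε) ^ (tau ε p - 1)⌉), Finset.mem_product.mpr
        ⟨tau_mem_Icc hN hN2 hcr hratio h1 h2, ceil_div_zpow_tau_mem_Icc hN hN2 hp⟩, rfl⟩)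
  have hcard : T.card ≤ (4 * N + 3) * N ^ 2 := by
    refine Finset.card_image_le.trans (le_of_eq ?_)
    rw [Finset.card_product, Int.card_Icc, Int.card_Icc]
    congr 1
    · omega
    · rw [add_sub_cancel_right]
      exact_mod_cast Int.toNat_natCast (N ^ 2)
  refine ⟨T.finite_toSet.subset hsub, ?_⟩
  calc S.ncard ≤ (T : Set ℝ).ncard := Set.ncard_le_ncard hsub T.finite_toSet
    _ = T.card := Set.ncard_coe_finset T
    _ ≤ (4 * N + 3) * N ^ 2 := hcard
    _ < 7 * N ^ 2 * N ^ 2 := Nat.mul_lt_mul_of_pos_right (by nlinarith) (by positivity)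
    _ = 7 * N ^ 4 := by ring
end

section
/- Let S be a finite nonempty set of machines, machine i ∈ S having parameters f_i, c_i, σ_i > 0 with f_i = c_i·σ_i, and let c_min = min_{i∈S} c_i. Let ε > 0 and let φ ≥ 0 be an integer multiple of ε·c_min. Let (L_i)_{i∈S} be nonnegative loads and (v_i)_{i∈S} nonnegative sand amounts with Σ_{i∈S} v_i ≤ φ. Then there exist nonnegative (v'_i)_{i∈S}, each an integer multiple of ε·c_min, such that Σ_{i∈S} v'_i ≤ φ, Σ_{i∈S} v'_i ≥ Σ_{i∈S} v_i, and Σ_{i∈S} cost_i(L_i + v'_i) ≤ (1+ε)·Σ_{i∈S} cost_i(L_i + v_i). -/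
theorem Finset.exists_le_sum_eq_of_le_sum {ι : Type*} (S : Finset ι) (m : ι → ℕ) (N : ℕ)
    (hN : N ≤ ∑ i ∈ S, m i) : ∃ n : ι → ℕ, (∀ i ∈ S, n i ≤ m i) ∧ ∑ i ∈ S, n i = N := by
  classical
  induction S using Finset.induction_on generalizing N with
  | empty => exact ⟨0, by simp_all⟩
  | insert j T hj ih =>
    rw [Finset.sum_insert hj] at hN
    obtain ⟨n, hn, hsum⟩ := ih (N - min N (m j)) (by omega)
    have hne : ∀ i ∈ T, i ≠ j := fun i hi h => hj (h ▸ hi)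
    refine ⟨Function.update n j (min N (m j)), fun i hi => ?_, ?_⟩
    · rcases Finset.mem_insert.1 hi with rfl | hi
      · simp
      · simpa [hne i hi] using hn i hi
    · rw [Finset.sum_insert hj, Finset.sum_congr rfl
        (fun i hi => Function.update_of_ne (hne i hi) _ n), hsum, Function.update_self]
      omega

/-- Increasing the load by at most `ε * c` increases the cost by at most a factor `1 + ε`. -/
theorem mcost_le_one_add_mul_mcost {f c σ ε x y : ℝ} (hσ : 0 < σ) (hε : 0 < ε)
    (hc : 0 < c) (hf : f = c * σ) (hxy : y ≤ x + ε * c) :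
    mcost f c σ y ≤ (1 + ε) * mcost f c σ x := by
  have hy : σ * y ≤ σ * (x + ε * c) := mul_le_mul_of_nonneg_left hxy hσ.le
  have hεf : 0 < ε * (c * σ) := by positivity
  subst hf
  unfold mcost
  split_ifs with h1 h2 h2
  · linarith
  · have : 0 < σ * (x - c) := mul_pos hσ (by linarith)
    have := mul_pos hε this
    linarith
  · have := mul_le_mul_of_nonneg_left h2 hσ.le
    linarith
  · have := mul_pos hε (mul_pos hσ (show 0 < x - c by linarith))
    linarith

theorem stmt13 {ι : Type*} (S : Finset ι) (hS : S.Nonempty)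
    (f c σ : ι → ℝ)
    (hf : ∀ i ∈ S, 0 < f i) (hc : ∀ i ∈ S, 0 < c i) (hσ : ∀ i ∈ S, 0 < σ i)
    (hfcσ : ∀ i ∈ S, f i = c i * σ i)
    (cmin : ℝ) (hcmin : cmin = S.inf' hS c)
    (ε : ℝ) (hε : 0 < ε)
    (φ : ℝ) (hφ0 : 0 ≤ φ) (a : ℕ) (hφ : φ = (a : ℝ) * (ε * cmin))
    (L v : ι → ℝ) (hL : ∀ i ∈ S, 0 ≤ L i) (hv : ∀ i ∈ S, 0 ≤ v i)
    (hvφ : ∑ i ∈ S, v i ≤ φ) :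
    ∃ v' : ι → ℝ,
      (∀ i ∈ S, 0 ≤ v' i) ∧
      (∀ i ∈ S, ∃ b : ℕ, v' i = (b : ℝ) * (ε * cmin)) ∧
      ∑ i ∈ S, v' i ≤ φ ∧
      ∑ i ∈ S, v i ≤ ∑ i ∈ S, v' i ∧
      ∑ i ∈ S, mcost (f i) (c i) (σ i) (L i + v' i) ≤
        (1 + ε) * ∑ i ∈ S, mcost (f i) (c i) (σ i) (L i + v i) := by
  have hcm : ∀ i ∈ S, cmin ≤ c i := fun i hi => hcmin ▸ Finset.inf'_le c hi
  have hcm0 : 0 < cmin := hcmin ▸ (Finset.lt_inf'_iff hS).2 hc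
  have hd : 0 < ε * cmin := mul_pos hε hcm0
  set d := ε * cmin with hd_def
  have hceil : ∑ i ∈ S, v i ≤ ((∑ i ∈ S, ⌈v i / d⌉₊ : ℕ) : ℝ) * d := by
    rw [Nat.cast_sum, Finset.sum_mul]
    exact Finset.sum_le_sum fun i _ => (div_le_iff₀ hd).1 (Nat.le_ceil _)
  obtain ⟨n, hn, hsum⟩ := S.exists_le_sum_eq_of_le_sum (fun i => ⌈v i / d⌉₊)
    (min a (∑ i ∈ S, ⌈v i / d⌉₊)) (min_le_right _ _)
  have hsum' : ∑ i ∈ S, (n i : ℝ) * d = ((min a (∑ i ∈ S, ⌈v i / d⌉₊) : ℕ) : ℝ) * d := by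
    rw [← Finset.sum_mul, ← hsum, Nat.cast_sum]
  refine ⟨fun i => n i * d, fun i _ => by positivity, fun i _ => ⟨n i, rfl⟩, ?_, ?_, ?_⟩
  · rw [hsum', hφ]
    gcongr
    exact min_le_left _ _
  · rw [hsum']
    rcases min_choice a (∑ i ∈ S, ⌈v i / d⌉₊) with h | h <;> rw [h]
    · exact hφ ▸ hvφ
    · exact hceil
  · rw [Finset.mul_sum]
    refine Finset.sum_le_sum fun i hi => mcost_le_one_add_mul_mcost (hσ i hi) hε (hc i hi)
      (hfcσ i hi) ?_
    have h1 : (n i : ℝ) ≤ v i / d + 1 :=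
      (Nat.cast_le.2 (hn i hi)).trans (Nat.ceil_lt_add_one (div_nonneg (hv i hi) hd.le)).le
    have h2 : (n i : ℝ) * d ≤ v i + d := by
      calc (n i : ℝ) * d ≤ (v i / d + 1) * d := by gcongr
        _ = v i + d := by field_simp
    have h3 : d ≤ ε * c i := mul_le_mul_of_nonneg_left (hcm i hi) hε.le
    linarith
end

section
/- Let C > 0 and let a finite family of items have sizes in (0, C] with total size L > C. Then the items can be partitioned into b subsets, each of total size at most C, such that b < 2L/C. -/
/-- A packing into bins of capacity `C` that uses as few bins as possible: any two distinct
nonempty bins together exceed the capacity. -/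
theorem exists_packing_with_heavy_pairs {ι : Type*} [Fintype ι] [DecidableEq ι]
    (C : ℝ) (hC : 0 ≤ C) (s : ι → ℝ) (hs : ∀ i, s i ≤ C) :
    ∃ f : ι → ι,
      (∀ t, ∑ i with f i = t, s i ≤ C) ∧
      ∀ t ∈ Finset.univ.image f, ∀ u ∈ Finset.univ.image f, t ≠ u →
        C < ∑ i with f i = t, s i + ∑ i with f i = u, s i := by
  classical
  let P : Finset (ι → ι) := Finset.univ.filter fun f => ∀ t, ∑ i with f i = t, s i ≤ C
  have hP : P.Nonempty := ⟨id, by simpa [P, Finset.sum_filter] using hs⟩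
  obtain ⟨f, hf, hmin⟩ := P.exists_min_image (fun f => (Finset.univ.image f).card) hP
  have hfC : ∀ t, ∑ i with f i = t, s i ≤ C := by simpa [P] using hf
  refine ⟨f, hfC, fun t ht u hu htu => ?_⟩
  by_contra! hle
  let f' : ι → ι := fun i => if f i = u then t else f i
  have hf' : f' ∈ P := by
    simp only [P, Finset.mem_filter_univ]
    intro v
    by_cases hvt : v = t
    · subst hvt
      refine le_of_eq_of_le ?_ hle
      simp only [Finset.sum_filter, ← Finset.sum_add_distrib]
      refine Finset.sum_congr rfl fun i _ => ?_
      grind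
    · by_cases hvu : v = u
      · refine le_of_eq_of_le (Finset.sum_eq_zero fun i hi => ?_) hC
        grind
      · refine le_of_eq_of_le (Finset.sum_congr ?_ fun _ _ => rfl) (hfC v)
        grind
  have hsub : Finset.univ.image f' ⊆ (Finset.univ.image f).erase u := by
    intro v hv
    grind
  exact absurd (hmin f' hf')
    (not_le.mpr ((Finset.card_le_card hsub).trans_lt (Finset.card_erase_lt_of_mem hu)))

/-- If at least two reals are given and any two of them have sum exceeding `C`, then their
average exceeds `C / 2`. -/
theorem mul_lt_two_mul_sum_of_pairwise {b : ℕ} (hb : 2 ≤ b) (C : ℝ) (w : Fin b → ℝ)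
    (hw : ∀ t u, t ≠ u → C < w t + w u) : b * C < 2 * ∑ t, w t := by
  obtain ⟨n, rfl⟩ := Nat.exists_eq_add_of_le' hb
  have hlt : ∑ _t : Fin (n + 2), C < ∑ t : Fin (n + 2), (w t + w (t + 1)) :=
    Finset.sum_lt_sum_of_nonempty Finset.univ_nonempty fun t _ => hw t (t + 1) (by simp)
  have hshift : ∑ t, w (t + 1) = ∑ t, w t := Equiv.sum_comp (Equiv.addRight 1) w
  rw [Finset.sum_add_distrib, hshift, Finset.sum_const, Finset.card_univ, Fintype.card_fin,
    nsmul_eq_mul] at hlt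
  linarith

theorem stmt15 {ι : Type*} [Fintype ι] [DecidableEq ι]
    (C : ℝ) (hC : 0 < C) (s : ι → ℝ)
    (hs : ∀ i, 0 < s i ∧ s i ≤ C)
    (L : ℝ) (hL : L = ∑ i, s i) (hLC : C < L) :
    ∃ (b : ℕ) (g : ι → Fin b),
      Function.Surjective g ∧
      (∀ t : Fin b, ∑ i ∈ Finset.univ.filter (fun i => g i = t), s i ≤ C) ∧
      (b : ℝ) < 2 * L / C := by
  obtain ⟨f, hfC, hpair⟩ := exists_packing_with_heavy_pairs C hC.le s fun i => (hs i).2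
  let e := (Finset.univ.image f).equivFin
  let g : ι → Fin (Finset.univ.image f).card :=
    fun i => e ⟨f i, Finset.mem_image_of_mem f (Finset.mem_univ i)⟩
  have hg : ∀ i t, g i = t ↔ f i = e.symm t := fun i t =>
    e.eq_symm_apply.symm.trans Subtype.ext_iff
  have hsum : ∑ t, ∑ i with g i = t, s i = L := by
    rw [hL, Finset.sum_fiberwise]
  have hbin : ∀ t, ∑ i with g i = t, s i ≤ C := fun t => by
    simpa only [hg] using hfC (e.symm t)
  refine ⟨_, g, fun t => ?_, hbin, ?_⟩
  · obtain ⟨i, -, hi⟩ := Finset.mem_image.mp (e.symm t).2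
    exact ⟨i, (hg i t).mpr hi⟩
  · rw [lt_div_iff₀ hC, ← hsum]
    refine mul_lt_two_mul_sum_of_pairwise ?_ C _ fun t u htu => ?_
    · by_contra! hlt
      have hcard := Finset.sum_le_card_nsmul Finset.univ _ C fun t _ => hbin t
      rw [hsum, Finset.card_univ, Fintype.card_fin, nsmul_eq_mul] at hcard
      have hb : ((Finset.univ.image f).card : ℝ) ≤ 1 := by exact_mod_cast Nat.le_of_lt_succ hlt
      nlinarith
    · simpa only [hg] using hpair _ (e.symm t).2 _ (e.symm u).2
        fun h => htu (e.symm.injective (Subtype.ext h))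
end

section
/- Consider an instance of BPc with m machine types satisfying f_i = c_i·σ_i for every type i, jobs with sizes p_j ≥ 0, and a capacity bound C > 0 with p_j ≤ C for all j. Define π(x) = min_{1≤i≤m} cost_i(x·C) for x ∈ [0,1]. Then π is monotone non-decreasing on [0,1], and the minimum cost of a BPc solution in which every machine has load at most C equals the minimum, over all partitions of the jobs into parts S_1,…,S_k each of total size at most C, of Σ_{l=1}^k π((Σ_{j∈S_l} p_j)/C). -/
/-- The load of machine `μ` under the job assignment `A` with job sizes `p`. -/
noncomputable def bload {M n : ℕ} (p : Fin n → ℝ) (A : Fin n → Fin M) (μ : Fin M) : ℝ :=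
  ∑ j ∈ Finset.univ.filter (fun j => A j = μ), p j

/-- The cost of a BPc solution consisting of `M` machines, machine `μ` having type `t μ`,
with jobs assigned via `A`. -/
noncomputable def bcost {m M n : ℕ} (f c σ : Fin m → ℝ) (p : Fin n → ℝ)
    (t : Fin M → Fin m) (A : Fin n → Fin M) : ℝ :=
  ∑ μ, mcost (f (t μ)) (c (t μ)) (σ (t μ)) (bload p A μ)

theorem mcost_mono (f c : ℝ) {σ : ℝ} (hσ : 0 ≤ σ) : Monotone (mcost f c σ) := by
  intro x y hxy
  unfold mcost
  split_ifs with hx hy hy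
  · exact le_rfl
  · exact le_add_of_nonneg_right (mul_nonneg hσ (by linarith))
  · linarith
  · gcongr

theorem mcost_nonneg {f σ : ℝ} (hf : 0 ≤ f) (c : ℝ) (hσ : 0 ≤ σ) (L : ℝ) :
    0 ≤ mcost f c σ L := by
  unfold mcost
  split_ifs with h
  · exact hf
  · exact add_nonneg hf (mul_nonneg hσ (by linarith))

/-- Values attained on the partitions of `Fin n` into nonempty parts form a finite set. -/
theorem finite_surjective_values {n : ℕ} (P : ∀ k, (Fin n → Fin k) → Prop)
    (F : ∀ k, (Fin n → Fin k) → ℝ) :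
    {r : ℝ | ∃ (k : ℕ) (g : Fin n → Fin k),
      Function.Surjective g ∧ P k g ∧ r = F k g}.Finite := by
  refine ((Set.finite_Iic n).biUnion fun k _ => Set.finite_range (F k)).subset ?_
  rintro r ⟨k, g, hg, -, rfl⟩
  refine Set.mem_biUnion (x := k) ?_ ⟨g, rfl⟩
  simpa using Fintype.card_le_of_surjective g hg

/-- Every map to `Fin M` factors as a surjection onto some `Fin k` followed by an injection. -/
theorem exists_surjective_injective_factor {n M : ℕ} (A : Fin n → Fin M) :
    ∃ (k : ℕ) (g : Fin n → Fin k) (e : Fin k → Fin M),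
      Function.Surjective g ∧ Function.Injective e ∧ ∀ j, e (g j) = A j := by
  classical
  let φ := Fintype.equivFin (Set.range A)
  exact ⟨_, φ ∘ Set.rangeFactorization A, Subtype.val ∘ φ.symm,
    φ.surjective.comp Set.rangeFactorization_surjective,
    Subtype.val_injective.comp φ.symm.injective, fun j => by simp⟩

theorem bload_comp_injective {n k M : ℕ} (p : Fin n → ℝ) {A : Fin n → Fin M}
    {g : Fin n → Fin k} {e : Fin k → Fin M} (he : Function.Injective e)
    (hA : ∀ j, e (g j) = A j) (l : Fin k) : bload p A (e l) = bload p g l := by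
  unfold bload
  congr 1
  ext j
  simp [← hA, he.eq_iff]

theorem stmt18 (m n : ℕ) (hm : 0 < m) (f c σ : Fin m → ℝ) (p : Fin n → ℝ)
    (hf : ∀ i, 0 < f i) (hc : ∀ i, 0 < c i) (hσ : ∀ i, 0 < σ i)
    (hfcσ : ∀ i, f i = c i * σ i) (hp : ∀ j, 0 ≤ p j)
    (C : ℝ) (hC : 0 < C) (hpC : ∀ j, p j ≤ C)
    (π : ℝ → ℝ)
    (hπ : ∀ x : ℝ,
      IsLeast {y : ℝ | ∃ i : Fin m, y = mcost (f i) (c i) (σ i) (x * C)} (π x)) :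
    (∀ x y : ℝ, 0 ≤ x → x ≤ y → y ≤ 1 → π x ≤ π y) ∧
    ∃ r : ℝ,
      IsLeast {r : ℝ | ∃ (M : ℕ) (t : Fin M → Fin m) (A : Fin n → Fin M),
        (∀ μ : Fin M, bload p A μ ≤ C) ∧ r = bcost f c σ p t A} r ∧
      IsLeast {r : ℝ | ∃ (k : ℕ) (g : Fin n → Fin k),
        Function.Surjective g ∧
        (∀ l : Fin k, ∑ j ∈ Finset.univ.filter (fun j => g j = l), p j ≤ C) ∧
        r = ∑ l : Fin k,
          π ((∑ j ∈ Finset.univ.filter (fun j => g j = l), p j) / C)} r := by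
  have hle (i : Fin m) (L : ℝ) : π (L / C) ≤ mcost (f i) (c i) (σ i) L :=
    (hπ (L / C)).2 ⟨i, by rw [div_mul_cancel₀ _ hC.ne']⟩
  refine ⟨fun x y _ hxy _ => ?_, ?_⟩
  · obtain ⟨i, hi⟩ := (hπ y).1
    rw [hi]
    exact ((hπ x).2 ⟨i, rfl⟩).trans
      (mcost_mono _ _ (hσ i).le (mul_le_mul_of_nonneg_right hxy hC.le))
  obtain ⟨r, hr⟩ := (finite_surjective_values
    (fun k g => ∀ l : Fin k, ∑ j ∈ Finset.univ.filter (fun j => g j = l), p j ≤ C)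
    (fun k g => ∑ l : Fin k,
      π ((∑ j ∈ Finset.univ.filter (fun j => g j = l), p j) / C))).exists_minimal
    ⟨_, n, id, Function.surjective_id, fun l => by simpa [Finset.filter_eq'] using hpC l, rfl⟩
  have hrl := minimal_iff_isLeast.1 hr
  refine ⟨r, ⟨?_, ?_⟩, hrl⟩
  · obtain ⟨k, g, -, hload, hrg⟩ := hrl.1
    choose t ht using fun l : Fin k => (hπ (bload p g l / C)).1
    refine ⟨k, t, g, hload, hrg.trans (Finset.sum_congr rfl fun l _ => ?_)⟩
    exact (ht l).trans (by rw [div_mul_cancel₀ _ hC.ne'])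
  · rintro _ ⟨M, t, A, hload, rfl⟩
    obtain ⟨k, g, e, hg, he, hA⟩ := exists_surjective_injective_factor A
    have hb := bload_comp_injective p he hA
    calc r ≤ ∑ l : Fin k, π (bload p g l / C) :=
          hrl.2 ⟨k, g, hg, fun l => (hb l).symm.trans_le (hload (e l)), rfl⟩
      _ ≤ ∑ l : Fin k, mcost (f (t (e l))) (c (t (e l))) (σ (t (e l))) (bload p A (e l)) :=
          Finset.sum_le_sum fun l _ => by rw [hb]; exact hle _ _
      _ = ∑ μ ∈ Finset.univ.map ⟨e, he⟩,
            mcost (f (t μ)) (c (t μ)) (σ (t μ)) (bload p A μ) := by simp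
      _ ≤ bcost f c σ p t A :=
          Finset.sum_le_sum_of_subset_of_nonneg (Finset.subset_univ _)
            fun μ _ _ => mcost_nonneg (hf _).le _ (hσ _).le _
end
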